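/- Let G be a connected Eulerian digraph with vertex set V, and let V = W ⊔ Z be a partition of V into disjoint sets with Z nonempty. Let s ∈ W be a vertex having at least one neighbour in Z in the underlying undirected graph (i.e., there is z ∈ Z with (s,z) ∈ E or (z,s) ∈ E). Then the simple random walk on G satisfies E_s[τ_Z] ≤ 12·|W|². -/

import Mathlib

open Finset

/-- The out-degree of a vertex in a digraph. -/
def dout {V : Type} [Fintype V] (E : V → V → Prop) [DecidableRel E] (x : V) : ℕ :=
  (Finset.univ.filter fun y => E x y).card

/-- The in-degree of a vertex in a digraph. -/
def din {V : Type} [Fintype V] (E : V → V → Prop) [DecidableRel E] (x : V) : ℕ :=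
  (Finset.univ.filter fun y => E y x).card

/-- The number of directed edges of a digraph. -/
def numEdges {V : Type} [Fintype V] (E : V → V → Prop) [DecidableRel E] : ℕ :=
  ∑ x, dout E x

/-- The transition matrix of the (non-lazy) simple random walk on a digraph. -/
noncomputable def srwP {V : Type} [Fintype V] [DecidableEq V] (E : V → V → Prop)
    [DecidableRel E] : Matrix V V ℝ :=
  fun v w => if E v w then 1 / (dout E v : ℝ) else 0

/-- The probability that a Markov chain with transition matrix `P` follows the trajectory
`x 0, x 1, …, x t` (given that it starts at `x 0`). -/
noncomputable def pathWeight {V : Type} [Fintype V] (P : Matrix V V ℝ) {t : ℕ}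
    (x : Fin (t + 1) → V) : ℝ :=
  ∏ i : Fin t, P (x i.castSucc) (x i.succ)

/-- The substochastic matrix `Q` of the chain `P` killed on the set `A`:
`Q(x,y) = P(x,y)` if `x ∉ A` and `y ∉ A`, and `Q(x,y) = 0` otherwise. -/
noncomputable def hitQ {V : Type} [Fintype V] [DecidableEq V] (P : Matrix V V ℝ)
    (A : Finset V) : Matrix V V ℝ :=
  fun x y => if x ∉ A ∧ y ∉ A then P x y else 0

/-- The partial sums `∑_{t<T} ∑_{w∉A} Q^t(v,w)` of the series defining the expected hitting
time `E_v[τ_A] = ∑_{t=0}^∞ ∑_{w∉A} Q^t(v,w)`. -/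
noncomputable def hitTimePartial {V : Type} [Fintype V] [DecidableEq V] (P : Matrix V V ℝ)
    (A : Finset V) (v : V) (T : ℕ) : ℝ :=
  ∑ t ∈ Finset.range T, ∑ w ∈ Finset.univ.filter (fun w => w ∉ A), (hitQ P A ^ t) v w

/-- The expected number of visits to `w` before time `T` of the chain `P` killed on `A`, started
at `s`. -/
noncomputable def killedGreen {V : Type} [Fintype V] [DecidableEq V] (P : Matrix V V ℝ)
    (A : Finset V) (s : V) (T : ℕ) (w : V) : ℝ :=
  ∑ t ∈ Finset.range T, (hitQ P A ^ t) s w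

section KilledChain

variable {V : Type} [Fintype V] [DecidableEq V] {P : Matrix V V ℝ} {A : Finset V}

lemma hitTimePartial_eq_sum_killedGreen (P : Matrix V V ℝ) (A : Finset V) (v : V) (T : ℕ) :
    hitTimePartial P A v T =
      ∑ w ∈ Finset.univ.filter (fun w => w ∉ A), killedGreen P A v T w :=
  Finset.sum_comm

lemma hitQ_nonneg (hP : ∀ x y, 0 ≤ P x y) (x y : V) : 0 ≤ hitQ P A x y := by
  unfold hitQ
  split_ifs
  exacts [hP x y, le_rfl]

lemma hitQ_pow_nonneg (hP : ∀ x y, 0 ≤ P x y) (t : ℕ) (x y : V) : 0 ≤ (hitQ P A ^ t) x y := by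
  induction t generalizing y with
  | zero => rw [pow_zero, Matrix.one_apply]; split_ifs <;> norm_num
  | succ t ih =>
    rw [pow_succ, Matrix.mul_apply]
    exact Finset.sum_nonneg fun z _ => mul_nonneg (ih z) (hitQ_nonneg hP z y)

lemma killedGreen_nonneg (hP : ∀ x y, 0 ≤ P x y) (s : V) (T : ℕ) (w : V) :
    0 ≤ killedGreen P A s T w :=
  Finset.sum_nonneg fun t _ => hitQ_pow_nonneg hP t s w

lemma killedGreen_le_succ (hP : ∀ x y, 0 ≤ P x y) (s : V) (T : ℕ) (w : V) :
    killedGreen P A s T w ≤ killedGreen P A s (T + 1) w := by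
  unfold killedGreen
  rw [Finset.sum_range_succ]
  exact le_add_of_nonneg_right (hitQ_pow_nonneg hP T s w)

lemma killedGreen_succ (P : Matrix V V ℝ) (A : Finset V) (s : V) (T : ℕ) (w : V) :
    killedGreen P A s (T + 1) w =
      (if s = w then 1 else 0) + ∑ v, killedGreen P A s T v * hitQ P A v w := by
  unfold killedGreen
  rw [Finset.sum_range_succ', pow_zero, Matrix.one_apply, add_comm]
  simp_rw [pow_succ, Matrix.mul_apply, Finset.sum_mul]
  rw [Finset.sum_comm]

lemma killedGreen_eq_zero {s w : V} (hs : s ∉ A) (hw : w ∈ A) (T : ℕ) :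
    killedGreen P A s T w = 0 := by
  cases T with
  | zero => simp [killedGreen]
  | succ T =>
    have hsw : s ≠ w := fun h => hs (h ▸ hw)
    simp [killedGreen_succ, hitQ, hw, hsw]

/-- The total expected number of killings is at most one. -/
lemma sum_killedGreen_mul_killing_le_one (hP : ∀ x y, 0 ≤ P x y) (s : V) (T : ℕ) :
    ∑ w, killedGreen P A s T w * (1 - ∑ y, hitQ P A w y) ≤ 1 := by
  have hmono : ∑ w, killedGreen P A s T w ≤ ∑ w, killedGreen P A s (T + 1) w :=
    Finset.sum_le_sum fun w _ => killedGreen_le_succ hP s T w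
  simp_rw [killedGreen_succ] at hmono
  rw [Finset.sum_add_distrib, Finset.sum_comm] at hmono
  simp_rw [← Finset.mul_sum] at hmono
  simp only [Finset.sum_ite_eq, Finset.mem_univ, if_true] at hmono
  simp_rw [mul_sub, mul_one]
  rw [Finset.sum_sub_distrib]
  linarith

end KilledChain

section Eulerian

variable {V : Type} [Fintype V] {E : V → V → Prop} [DecidableRel E]

lemma sum_edge_right (x : V) : ∑ y, (if E x y then (1 : ℝ) else 0) = dout E x := by
  simp [dout]

lemma sum_edge_left (y : V) : ∑ x, (if E x y then (1 : ℝ) else 0) = din E y := by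
  simp [din]

/-- The Dirichlet form of an Eulerian digraph is that of its symmetrization. -/
lemma sum_edge_sub_sq (heul : ∀ x, dout E x = din E x) (f : V → ℝ) :
    ∑ x, ∑ y, (if E x y then (1 : ℝ) else 0) * (f x - f y) ^ 2 =
      2 * (∑ x, dout E x * f x ^ 2 - ∑ x, ∑ y, (if E x y then (1 : ℝ) else 0) * (f x * f y)) := by
  have hexp : ∀ x y, (if E x y then (1 : ℝ) else 0) * (f x - f y) ^ 2 =
      (if E x y then (1 : ℝ) else 0) * f x ^ 2 + (if E x y then (1 : ℝ) else 0) * f y ^ 2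
        - 2 * ((if E x y then (1 : ℝ) else 0) * (f x * f y)) := fun x y => by ring
  have hleft : ∑ x, ∑ y, (if E x y then (1 : ℝ) else 0) * f y ^ 2 = ∑ y, dout E y * f y ^ 2 := by
    rw [Finset.sum_comm]
    simp_rw [← Finset.sum_mul, sum_edge_left, heul]
  simp_rw [hexp, Finset.sum_sub_distrib, Finset.sum_add_distrib, hleft, ← Finset.mul_sum,
    ← Finset.sum_mul, sum_edge_right]
  ring

/-- An approximate Green function with pole `s` is at most `2` at `s` if it vanishes at a neighbour
of `s`. -/
lemma le_two_of_energy_le (heul : ∀ x, dout E x = din E x) (f : V → ℝ) {s z : V} (hz : f z = 0)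
    (hsz : E s z ∨ E z s)
    (henergy : ∑ x, dout E x * f x ^ 2 - ∑ x, ∑ y, (if E x y then (1 : ℝ) else 0) * (f x * f y)
      ≤ f s) : f s ≤ 2 := by
  have hterm : ∀ x y, 0 ≤ (if E x y then (1 : ℝ) else 0) * (f x - f y) ^ 2 := fun x y =>
    mul_nonneg (by split_ifs <;> norm_num) (sq_nonneg _)
  have hsingle : ∀ a b, E a b → (f a - f b) ^ 2 ≤ 2 * f s := fun a b hab => by
    have h₁ := Finset.single_le_sum (fun y _ => hterm a y) (Finset.mem_univ b)
    have h₂ := Finset.single_le_sum (fun x _ => Finset.sum_nonneg fun y (_ : y ∈ Finset.univ) => hterm x y)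
      (Finset.mem_univ a)
    have h₃ := sum_edge_sub_sq heul f
    simp only [hab, if_true, one_mul] at h₁
    linarith
  have hsq : f s ^ 2 ≤ 2 * f s := by
    rcases hsz with h | h
    · simpa [hz] using hsingle s z h
    · simpa [hz] using hsingle z s h
  nlinarith

variable [DecidableEq V] {Z : Finset V}

lemma srwP_eq (x y : V) :
    srwP E x y = (if E x y then (1 : ℝ) else 0) / dout E x := by
  unfold srwP
  split_ifs <;> simp

lemma srwP_nonneg (x y : V) : 0 ≤ srwP E x y := by
  rw [srwP_eq]
  split_ifs <;> positivity

lemma killedGreen_mul_hitQ_srwP_le (s : V) (T : ℕ) (v w : V) :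
    killedGreen (srwP E) Z s T v * hitQ (srwP E) Z v w ≤
      (if E v w then (1 : ℝ) else 0) * (killedGreen (srwP E) Z s T v / dout E v) := by
  have hle : hitQ (srwP E) Z v w ≤ srwP E v w := by
    unfold hitQ
    split_ifs
    exacts [le_rfl, srwP_nonneg v w]
  calc _ ≤ killedGreen (srwP E) Z s T v * srwP E v w :=
        mul_le_mul_of_nonneg_left hle (killedGreen_nonneg srwP_nonneg s T v)
    _ = _ := by rw [srwP_eq]; ring

lemma killedGreen_succ_srwP_le (s : V) (T : ℕ) (w : V) :
    killedGreen (srwP E) Z s (T + 1) w ≤ (if s = w then 1 else 0) +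
      ∑ v, (if E v w then (1 : ℝ) else 0) * (killedGreen (srwP E) Z s T v / dout E v) := by
  rw [killedGreen_succ]
  exact add_le_add le_rfl (Finset.sum_le_sum fun v _ =>
    killedGreen_mul_hitQ_srwP_le (E := E) s T v w)

lemma killedGreen_div_dout_self_le_two (heul : ∀ x, dout E x = din E x) {s z : V} (hs : s ∉ Z)
    (hz : z ∈ Z) (hsz : E s z ∨ E z s) (T : ℕ) :
    killedGreen (srwP E) Z s T s / dout E s ≤ 2 := by
  set f : V → ℝ := fun x => killedGreen (srwP E) Z s T x / dout E x with hf
  have hf0 : ∀ x, 0 ≤ f x := fun x =>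
    div_nonneg (killedGreen_nonneg (srwP_nonneg (E := E)) s T x) (Nat.cast_nonneg _)
  refine le_two_of_energy_le heul f (z := z) (by simp [hf, killedGreen_eq_zero hs hz]) hsz ?_
  have hpoint : ∀ w, (dout E w : ℝ) * f w ^ 2 ≤ (if s = w then f w else 0) +
      ∑ v, (if E v w then (1 : ℝ) else 0) * (f v * f w) := fun w => by
    have hmul : (dout E w : ℝ) * f w ≤ killedGreen (srwP E) Z s T w := by
      rw [hf, ← mul_div_assoc, mul_div_right_comm]
      exact mul_le_of_le_one_left (killedGreen_nonneg srwP_nonneg s T w) (div_self_le_one _)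
    have h := mul_le_mul_of_nonneg_right
      (hmul.trans ((killedGreen_le_succ srwP_nonneg s T w).trans (killedGreen_succ_srwP_le s T w)))
      (hf0 w)
    simp only [add_mul, ite_mul, one_mul, zero_mul, Finset.sum_mul] at h ⊢
    rw [sq, ← mul_assoc]
    exact h
  have hsum := Finset.sum_le_sum fun w (_ : w ∈ Finset.univ) => hpoint w
  rw [Finset.sum_add_distrib, Finset.sum_comm (f := fun w v => _ * (f v * f w))] at hsum
  simp only [Finset.sum_ite_eq, Finset.mem_univ, if_true] at hsum
  linarith

lemma killedGreen_le_two_mul_dout (heul : ∀ x, dout E x = din E x) {s z : V} (hs : s ∉ Z)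
    (hz : z ∈ Z) (hsz : E s z ∨ E z s) (T : ℕ) (w : V) :
    killedGreen (srwP E) Z s T w ≤ 2 * dout E w := by
  induction T generalizing w with
  | zero => simp [killedGreen]
  | succ T ih =>
    rcases eq_or_ne s w with rfl | hsw
    · have hpos : 0 < dout E s := by
        rcases hsz with h | h
        · exact Finset.card_pos.2 ⟨z, by simpa using h⟩
        · rw [heul]
          exact Finset.card_pos.2 ⟨z, by simpa using h⟩
      exact (div_le_iff₀ (by exact_mod_cast hpos)).1
        (killedGreen_div_dout_self_le_two heul hs hz hsz (T + 1))
    · have hle : ∀ v, killedGreen (srwP E) Z s T v / dout E v ≤ 2 := fun v =>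
        div_le_of_le_mul₀ (Nat.cast_nonneg _) zero_le_two (ih v)
      calc _ ≤ _ := killedGreen_succ_srwP_le s T w
        _ ≤ ∑ v, (if E v w then (1 : ℝ) else 0) * 2 := by
          rw [if_neg hsw, zero_add]
          gcongr with v
          exact hle v
        _ = 2 * dout E w := by rw [← Finset.sum_mul, sum_edge_left, heul, mul_comm]

lemma sum_hitQ_srwP_le (Z : Finset V) (w : V) :
    ∑ y, hitQ (srwP E) Z w y ≤ min 1 (((Zᶜ).card : ℝ) / dout E w) := by
  apply le_min
  · calc _ ≤ ∑ y, srwP E w y := Finset.sum_le_sum fun y _ => by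
          unfold hitQ
          split_ifs
          exacts [le_rfl, srwP_nonneg w y]
      _ = (dout E w : ℝ) / dout E w := by
          simp_rw [srwP_eq]
          rw [← Finset.sum_div, sum_edge_right]
      _ ≤ 1 := div_self_le_one _
  · calc _ ≤ ∑ y, if y ∈ Zᶜ then 1 / (dout E w : ℝ) else 0 := Finset.sum_le_sum fun y _ => by
          simp only [hitQ, srwP, Finset.mem_compl]
          split_ifs <;> first | positivity | simp_all
      _ = _ := by
          rw [Finset.sum_ite_mem, Finset.univ_inter, Finset.sum_const, nsmul_eq_mul, mul_one_div]

/-- Half of the time spent at vertices of degree at least `2 * |Zᶜ|` is killed in the next step. -/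
lemma killedGreen_le_add_killing (heul : ∀ x, dout E x = din E x) {s z : V} (hs : s ∉ Z)
    (hz : z ∈ Z) (hsz : E s z ∨ E z s) (T : ℕ) (w : V) :
    killedGreen (srwP E) Z s T w ≤ 4 * ((Zᶜ).card : ℝ) +
      2 * (killedGreen (srwP E) Z s T w * (1 - ∑ y, hitQ (srwP E) Z w y)) := by
  have hnonneg : 0 ≤ killedGreen (srwP E) Z s T w := killedGreen_nonneg srwP_nonneg s T w
  have hcard : (0 : ℝ) ≤ (Zᶜ).card := Nat.cast_nonneg _
  have hkill := le_min_iff.1 (sum_hitQ_srwP_le (E := E) Z w)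
  rcases le_or_gt (dout E w : ℝ) (2 * (Zᶜ).card) with hd | hd
  · have := killedGreen_le_two_mul_dout heul hs hz hsz T w
    have := mul_nonneg hnonneg (sub_nonneg.2 hkill.1)
    linarith
  · have hhalf : ∑ y, hitQ (srwP E) Z w y ≤ 1 / 2 :=
      hkill.2.trans (by rw [div_le_iff₀ (by linarith)]; linarith)
    nlinarith

end Eulerian

/-- Let `G` be a connected Eulerian digraph whose vertex set is partitioned
as `V = W ⊔ Z` with `Z` nonempty, and let `s ∈ W` have a neighbour in `Z` in the underlying
undirected graph. Then the simple random walk satisfies `E_s[τ_Z] ≤ 12·|W|²` (the expected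
hitting time `E_s[τ_Z] = ∑_{t=0}^∞ ∑_{w∉Z} Q^t(s,w)` being bounded through its partial
sums). -/
theorem eulerian_hitting_partition
    (V : Type) [Fintype V] [DecidableEq V] (E : V → V → Prop) [DecidableRel E]
    (hloop : ∀ x, ¬ E x x)
    (heul : ∀ x, dout E x = din E x)
    (hconn : (SimpleGraph.fromRel E).Connected)
    (W Z : Finset V) (hdisj : Disjoint W Z) (hunion : W ∪ Z = Finset.univ)
    (hZ : Z.Nonempty) (s : V) (hs : s ∈ W)
    (hadj : ∃ z ∈ Z, E s z ∨ E z s) :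
    ∀ T : ℕ, hitTimePartial (srwP E) Z s T ≤ 12 * (W.card : ℝ) ^ 2 := by
  intro T
  obtain ⟨z, hz, hsz⟩ := hadj
  have hsZ : s ∉ Z := Finset.disjoint_left.1 hdisj hs
  have hW : Zᶜ = W :=
    (IsCompl.of_eq (Finset.disjoint_iff_inter_eq_empty.1 hdisj) hunion).symm.compl_eq
  have hfilter : Finset.univ.filter (fun w => w ∉ Z) = W := by
    rw [← hW]
    ext
    simp
  have hcard : (1 : ℝ) ≤ W.card := by exact_mod_cast Finset.card_pos.2 ⟨s, hs⟩
  have hkill : ∑ w ∈ W, killedGreen (srwP E) Z s T w * (1 - ∑ y, hitQ (srwP E) Z w y) ≤ 1 :=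
    (Finset.sum_le_univ_sum_of_nonneg fun w => mul_nonneg (killedGreen_nonneg srwP_nonneg s T w)
      (sub_nonneg.2 (le_min_iff.1 (sum_hitQ_srwP_le Z w)).1)).trans
      (sum_killedGreen_mul_killing_le_one srwP_nonneg s T)
  have hsum := Finset.sum_le_sum fun w (_ : w ∈ W) =>
    killedGreen_le_add_killing heul hsZ hz hsz T w
  rw [Finset.sum_add_distrib, Finset.sum_const, nsmul_eq_mul, ← Finset.mul_sum, hW] at hsum
  rw [hitTimePartial_eq_sum_killedGreen, hfilter]
  nlinarith
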